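/- (Conjecture 3.) Fix integers n ≥ 1, r ≥ 1 and 1 ≤ s ≤ rn−1. For each d ≥ 0 let m_d be the number of decorated ordered set partitions ((L₁)_{l₁},…,(L_k)_{l_k}) of {1,…,n} with l₁+⋯+l_k = s, 1 ≤ l_i ≤ r|L_i|−1 for each i, 1 ∈ L₁, and winding number d. Then in the ring of formal power series ℤ[[x]], (1−x)^n · Σ_{t≥0} E(t) x^t = Σ_{d≥0} m_d x^d, where E(t) is the number of integer vectors y ∈ ℤ^n with 0 ≤ y_i ≤ rt for all i and y₁+⋯+y_n = st; that is, (m_0, m_1, m_2, …) is the Ehrhart h*-vector of the cross-section I_{r,s}^n. -/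

import Mathlib

/-- `P` is a decorated ordered set partition of `{1,…,n}` (encoded as `Fin n`)
with positive decorations summing to `a`: its blocks (the first components)
are pairwise disjoint nonempty subsets of `Fin n` covering all of `Fin n`, and
its decorations (the second components) are positive integers summing to `a`. -/
def IsDOSP (n a : ℕ) (P : List (Finset (Fin n) × ℕ)) : Prop :=
  (∀ B ∈ P, B.1.Nonempty ∧ 1 ≤ B.2) ∧
  List.Pairwise (fun B C => Disjoint B.1 C.1) P ∧
  (∀ x : Fin n, ∃ B ∈ P, x ∈ B.1) ∧
  (P.map Prod.snd).sum = a

/-- The element `1` of `{1,…,n}` (encoded as `0 : Fin n`) lies in the first block of `P`. -/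
def FirstBlock {n : ℕ} (P : List (Finset (Fin n) × ℕ)) : Prop :=
  ∀ x : Fin n, (x : ℕ) = 0 → x ∈ P.headI.1

/-- The position `p_x` of `x`: the sum of the decorations of the blocks strictly
before the (first) block containing `x`. -/
def posOf {n : ℕ} (P : List (Finset (Fin n) × ℕ)) (x : Fin n) : ℕ :=
  ((P.takeWhile (fun B => decide (x ∉ B.1))).map Prod.snd).sum

/-- The cyclic successor on `Fin n` (`n` maps back to `1`). -/
def cyc {n : ℕ} (i : Fin n) : Fin n := ⟨((i : ℕ) + 1) % n, Nat.mod_lt _ i.pos⟩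

/-- The winding-vector entry `w_i ∈ {0,…,a−1}`: the representative of
`p_{i+1} − p_i` modulo `a` for `i = 1,…,n−1`, and of `p_1 − p_n` for `i = n`. -/
def wind {n : ℕ} (a : ℕ) (P : List (Finset (Fin n) × ℕ)) (i : Fin n) : ℕ :=
  (((posOf P (cyc i) : ℤ) - (posOf P i : ℤ)) % (a : ℤ)).toNat

/-- The level `w₁ + ⋯ + w_n` of `P`. -/
def level {n : ℕ} (a : ℕ) (P : List (Finset (Fin n) × ℕ)) : ℕ :=
  ∑ i : Fin n, wind a P i

open PowerSeries in
theorem coeff_prod_univ {R ι : Type*} [CommSemiring R] [Fintype ι] [DecidableEq ι]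
    (f : ι → PowerSeries R) (d : ℕ) :
    coeff d (∏ i, f i) =
      ∑ l ∈ Finset.piAntidiag Finset.univ d, ∏ i, coeff (l i) (f i) := by
  rw [PowerSeries.coeff_prod]
  refine Finset.sum_bij' (fun l _ => ⇑l) (fun l _ => Finsupp.equivFunOnFinite.symm l)
    ?_ ?_ ?_ ?_ ?_
  · intro l hl; simp_all
  · intro l hl; simp_all
  · intro l _; ext; simp
  · intro l _; ext; simp
  · intro l _; rfl

open PowerSeries in
theorem coeff_mk_one_pow (R : Type*) [CommRing R] (t c : ℕ) :
    coeff c ((mk 1 : PowerSeries R) ^ t) = (Nat.multichoose t c : R) := by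
  cases t with
  | zero => cases c <;> simp [coeff_one]
  | succ d =>
    rw [mk_one_pow_eq_mk_choose_add, coeff_mk, Nat.multichoose_eq, Nat.choose_symm_add,
      show d + 1 + c - 1 = d + c by omega]

open PowerSeries in
theorem card_lattice_points (n m M : ℕ) :
    (Nat.card {y : Fin n → ℤ // (∀ i, 0 ≤ y i ∧ y i ≤ (m : ℤ)) ∧ ∑ i, y i = (M : ℤ)} : ℤ) =
      ∑ i ∈ Finset.range (n + 1), (-1) ^ i * (n.choose i : ℤ) *
        (if (m + 1) * i ≤ M then (Nat.multichoose n (M - (m + 1) * i) : ℤ) else 0) := by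
  have h1 : Nat.card {y : Fin n → ℤ // (∀ i, 0 ≤ y i ∧ y i ≤ (m : ℤ)) ∧ ∑ i, y i = (M : ℤ)}
      = ((Finset.piAntidiag (Finset.univ : Finset (Fin n)) M).filter
          (fun y => ∀ i, y i ≤ m)).card := by
    rw [← Nat.card_eq_finsetCard]
    refine Nat.card_congr ⟨fun y => ⟨fun i => (y.1 i).toNat, ?_⟩,
      fun y => ⟨fun i => (y.1 i : ℤ), ?_⟩, ?_, ?_⟩
    · obtain ⟨y, hy, hs⟩ := y
      simp only [Finset.mem_filter, Finset.mem_piAntidiag, Finset.mem_univ, implies_true, and_true]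
      refine ⟨?_, fun i => by have := hy i; omega⟩
      zify
      rw [← hs]
      exact Finset.sum_congr rfl fun i _ => Int.toNat_of_nonneg (hy i).1
    · obtain ⟨y, hy⟩ := y
      simp only [Finset.mem_filter, Finset.mem_piAntidiag, Finset.mem_univ, implies_true,
        and_true] at hy
      exact ⟨fun i => ⟨Int.natCast_nonneg _, Int.ofNat_le.2 (hy.2 i)⟩,
        (Nat.cast_sum _ _).symm.trans (congrArg _ hy.1)⟩
    · rintro ⟨y, hy, hs⟩
      ext i
      exact Int.toNat_of_nonneg (hy i).1
    · rintro ⟨y, hy⟩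
      simp
  have h2 : (((Finset.piAntidiag (Finset.univ : Finset (Fin n)) M).filter
          (fun y => ∀ i, y i ≤ m)).card : ℤ)
      = coeff M ((mk fun j => if j ≤ m then (1 : ℤ) else 0) ^ n) := by
    have := coeff_prod_univ (fun _ : Fin n => (mk fun j => if j ≤ m then (1 : ℤ) else 0)) M
    rw [Finset.prod_const, Finset.card_univ, Fintype.card_fin] at this
    rw [this, Finset.card_filter, Nat.cast_sum]
    refine Finset.sum_congr rfl fun y _ => ?_
    simp [Finset.prod_ite_zero]
  have h3 : (mk fun j => if j ≤ m then (1 : ℤ) else 0) = (1 - X ^ (m + 1)) * mk 1 := by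
    ext j
    rw [sub_mul, one_mul, map_sub, coeff_X_pow_mul']
    simp only [coeff_mk, Pi.one_apply]
    split_ifs <;> omega
  have h4 : (1 - X ^ (m + 1) : PowerSeries ℤ) ^ n =
      ∑ i ∈ Finset.range (n + 1), C ((-1) ^ i * (n.choose i : ℤ)) * X ^ ((m + 1) * i) := by
    rw [sub_eq_neg_add, add_pow]
    refine Finset.sum_congr rfl fun i _ => ?_
    rw [neg_pow, pow_mul]
    simp
    ring
  rw [h1, h2, h3, mul_pow, h4, Finset.sum_mul, map_sum]
  refine Finset.sum_congr rfl fun i _ => ?_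
  rw [mul_assoc, coeff_C_mul, coeff_X_pow_mul', coeff_mk_one_pow]

open PowerSeries in
/-- The bivariate series over pairs `(c, l)` with `1 ≤ l ≤ r c - 1`: a block of `c` elements with
decoration `l`, weighted by the number of ways to distribute `c` stops over `t` turns. -/
noncomputable def blockSeries (r t : ℕ) : PowerSeries (PowerSeries ℤ) :=
  mk fun c => (Nat.multichoose t c : PowerSeries ℤ) * ∑ l ∈ Finset.Icc 1 (r * c - 1), X ^ l

open PowerSeries in
/-- The analogue of `blockSeries` for the first block, which contains the starting element. -/
noncomputable def firstBlockSeries (r t : ℕ) : PowerSeries (PowerSeries ℤ) :=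
  mk fun c => (Nat.multichoose (t + 1) (c - 1) : PowerSeries ℤ) *
    ∑ l ∈ Finset.Icc 1 (r * c - 1), X ^ l

open PowerSeries in
theorem one_sub_mul_sum_Icc_pow (m : ℕ) (hm : 1 ≤ m) :
    (1 - X : PowerSeries ℤ) * ∑ l ∈ Finset.Icc 1 (m - 1), X ^ l = X - X ^ m := by
  induction m, hm using Nat.le_induction with
  | base => simp
  | succ m hm ih =>
    obtain ⟨k, rfl⟩ : ∃ k, m = k + 1 := ⟨m - 1, by omega⟩
    simp only [Nat.add_sub_cancel] at ih ⊢
    rw [Finset.sum_Icc_succ_top (by omega), mul_add, ih]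
    ring

open PowerSeries in
theorem one_sub_mul_blockSeries (r t : ℕ) (hr : 1 ≤ r) :
    C (1 - X : PowerSeries ℤ) * blockSeries r t =
      C X * ((mk 1) ^ t - 1) - ((rescale (X ^ r : PowerSeries ℤ) (mk 1)) ^ t - 1) := by
  ext1 c
  rw [← map_pow]
  rw [blockSeries, coeff_C_mul, coeff_mk]
  simp only [coeff_C_mul, map_sub, coeff_mk_one_pow, coeff_rescale,
    coeff_one]
  rw [mul_left_comm]
  rcases Nat.eq_zero_or_pos c with rfl | hc
  · simp
  · rw [one_sub_mul_sum_Icc_pow _ (Nat.mul_pos hr hc), if_neg hc.ne', pow_mul]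
    ring

open PowerSeries in
theorem one_sub_mul_firstBlockSeries (r t : ℕ) (hr : 1 ≤ r) :
    C (1 - X : PowerSeries ℤ) * firstBlockSeries r t =
      C X * (X * (mk 1) ^ (t + 1)) -
        C (X ^ r) * X * (rescale (X ^ r : PowerSeries ℤ) (mk 1)) ^ (t + 1) := by
  ext1 c
  rw [← map_pow, mul_assoc (C (X ^ r))]
  rw [firstBlockSeries, coeff_C_mul, coeff_mk]
  simp only [coeff_C_mul, map_sub]
  rw [mul_left_comm]
  rcases c with _ | c
  · simp
  · rw [one_sub_mul_sum_Icc_pow _ (Nat.mul_pos hr c.succ_pos), coeff_succ_X_mul, coeff_succ_X_mul,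
      coeff_rescale, coeff_mk_one_pow, Nat.add_sub_cancel, pow_mul, pow_succ]
    ring

open PowerSeries in
theorem C_X_dvd_of_Icc (r : ℕ) (f : ℕ → PowerSeries ℤ) :
    C (X : PowerSeries ℤ) ∣ mk fun c => f c * ∑ l ∈ Finset.Icc 1 (r * c - 1), X ^ l := by
  have h : ∀ m : ℕ, (X : PowerSeries ℤ) ∣ ∑ l ∈ Finset.Icc 1 m, X ^ l := fun m =>
    Finset.dvd_sum fun l hl => dvd_pow_self _ (by have := Finset.mem_Icc.1 hl; omega)
  choose g hg using h
  refine ⟨mk fun c => f c * g (r * c - 1), ?_⟩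
  ext1 c
  rw [coeff_C_mul, coeff_mk, coeff_mk, hg]
  ring

/-- A closed form for a finite geometric sum, modulo a high power of `q`. -/
theorem geometric_elimination {S : Type*} [CommRing S] (q Q u α b β B B' Z : S) (s t : ℕ)
    (hβ : β * α = 1)
    (hB : (1 - q) * B = q * (b ^ t - 1) - (β ^ t - 1))
    (hB' : (1 - q) * B' = q * (u * b ^ (t + 1)) - Q * u * β ^ (t + 1))
    (hZ : B' * B ^ s = q ^ (s + 1) * Z) :
    ∃ Y, ∑ k ∈ Finset.range s, B' * B ^ k =
      -(Q * u * β) + ∑ k ∈ Finset.range s, (q * (α * b) ^ t) ^ (k + 1) * (u * (b - Q * β)) +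
        q ^ (s + 1) * Y := by
  set R := (α * b) ^ t with hR
  set T := ∑ k ∈ Finset.range s, B' * B ^ k with hT
  have h1 : T * (1 - B) = B' - B' * B ^ s := by
    rw [hT, ← Finset.mul_sum, mul_assoc, geom_sum_mul_neg]; ring
  have h2 : T * (β ^ t - q * b ^ t) =
      q * (u * b ^ (t + 1)) - Q * u * β ^ (t + 1) - (1 - q) * (q ^ (s + 1) * Z) := by
    linear_combination (1 - q) * h1 + T * hB + hB' - (1 - q) * hZ
  have hβt : β ^ t * α ^ t = 1 := by rw [← mul_pow, hβ, one_pow]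
  have h3 : T * (1 - q * R) =
      q * R * (u * b) - Q * u * β - α ^ t * (1 - q) * (q ^ (s + 1) * Z) := by
    rw [hR, mul_pow]
    linear_combination α ^ t * h2 - (T + Q * u * β) * hβt
  set H := ∑ k ∈ Finset.range (s + 1), (q * R) ^ k with hH
  have h4 : H * (1 - q * R) = 1 - (q * R) ^ (s + 1) := geom_sum_mul_neg _ _
  have h5 : q * R * H = ∑ k ∈ Finset.range s, (q * R) ^ (k + 1) + (q * R) ^ (s + 1) := by
    rw [hH, Finset.mul_sum, ← Finset.sum_range_succ]
    exact Finset.sum_congr rfl fun k _ => by ring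
  rw [← Finset.sum_mul]
  refine ⟨R ^ (s + 1) * (T + Q * u * β + u * (b - Q * β)) - H * α ^ t * (1 - q) * Z, ?_⟩
  rw [mul_pow] at h4 h5
  linear_combination H * h3 - (T + Q * u * β) * h4 + u * (b - Q * β) * h5

open PowerSeries in
theorem derivative_mk_one (R : Type*) [CommRing R] :
    derivative R (mk 1 : PowerSeries R) = mk 1 ^ 2 := by
  ext n
  rw [coeff_derivative, coeff_mk_one_pow, coeff_mk]
  simp [Nat.multichoose_two]

open PowerSeries in
theorem X_mul_derivative_ratio_pow {R : Type*} [CommRing R] (Q : R) (β : PowerSeries R)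
    (hβ : β * (1 - C Q * X) = 1) (K : ℕ) :
    X * derivative R (((1 - C Q * X) * mk 1) ^ K) =
      (K : PowerSeries R) * (((1 - C Q * X) * mk 1) ^ K * (X * (mk 1 - C Q * β))) := by
  rw [derivative_pow, Derivation.leibniz, derivative_mk_one, map_sub, Derivation.leibniz,
    derivative_X, derivative_C, derivative_one]
  simp only [smul_eq_mul]
  rcases K with _ | K
  · simp
  · rw [Nat.add_sub_cancel]
    have h : ((1 - C Q * X) * mk 1 : PowerSeries R) ^ (K + 1) =
      ((1 - C Q * X) * mk 1) ^ K * ((1 - C Q * X) * mk 1) := pow_succ _ _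
    rw [h]
    linear_combination
      ((K + 1 : ℕ) * ((1 - C Q * X) * mk 1 : PowerSeries R) ^ K * X * mk 1 * C Q) * hβ

open PowerSeries in
theorem coeff_ratio_pow {R : Type*} [CommRing R] (Q : R) (K n : ℕ) :
    coeff n (((1 - C Q * X) * mk 1 : PowerSeries R) ^ K) =
      ∑ i ∈ Finset.range (n + 1),
        (-Q) ^ i * ((K.choose i * Nat.multichoose K (n - i) : ℕ) : R) := by
  have h : ∀ i, coeff i ((1 - C Q * X : PowerSeries R) ^ K) = (-Q) ^ i * (K.choose i : R) := by
    intro i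
    have : (1 - C Q * X : PowerSeries R) = rescale (-Q) (1 + X) := by
      simp [rescale_X, sub_eq_add_neg]
    rw [this, ← map_pow, coeff_rescale]
    congr 1
    have h2 : ((1 + X : PowerSeries R) ^ K) = (((1 + Polynomial.X) ^ K : Polynomial R) :) := by
      simp
    rw [h2, Polynomial.coeff_coe, Polynomial.coeff_one_add_X_pow]
  rw [mul_pow, coeff_mul, Finset.Nat.sum_antidiagonal_eq_sum_range_succ_mk]
  refine Finset.sum_congr rfl fun i _ => ?_
  rw [h, coeff_mk_one_pow]
  push_cast
  ring

theorem mul_choose_mul_multichoose (n K i : ℕ) (hn : 1 ≤ n) (hK : 1 ≤ K) (hi : i ≤ n) :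
    n * (K.choose i * Nat.multichoose K (n - i)) =
      K * (n.choose i * if i ≤ K then Nat.multichoose n (K - i) else 0) := by
  split_ifs with hiK
  · obtain ⟨a, rfl⟩ := Nat.exists_eq_add_of_le hi
    obtain ⟨c, rfl⟩ := Nat.exists_eq_add_of_le hiK
    rw [Nat.multichoose_eq, Nat.multichoose_eq, Nat.add_sub_cancel_left, Nat.add_sub_cancel_left]
    obtain ⟨m, hm⟩ : ∃ m, i + a = m + 1 := ⟨i + a - 1, by omega⟩
    obtain ⟨p, hp⟩ : ∃ p, i + c = p + 1 := ⟨i + c - 1, by omega⟩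
    have e1 : i + c + a - 1 = p + a := by omega
    have e2 : i + a + c - 1 = p + a := by omega
    have e3 : p + a = m + c := by omega
    rw [e1, e2]
    have f1 := Nat.add_choose_mul_factorial_mul_factorial i c
    have f2 := Nat.add_choose_mul_factorial_mul_factorial i a
    have f3 := Nat.add_choose_mul_factorial_mul_factorial p a
    have f4 := Nat.add_choose_mul_factorial_mul_factorial m c
    rw [← e3] at f4
    rw [← Nat.choose_symm_add, hp, Nat.factorial_succ] at f1
    rw [← Nat.choose_symm_add, hm, Nat.factorial_succ] at f2
    rw [hm, hp]
    have hpos : 0 < i.factorial * c.factorial * a.factorial * p.factorial * m.factorial := by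
      positivity
    apply Nat.eq_of_mul_eq_mul_right hpos
    calc _ = (m + 1) * ((p + 1).choose i * i.factorial * c.factorial) *
          ((p + a).choose a * p.factorial * a.factorial) * m.factorial := by ring
      _ = (p + 1) * ((m + 1).choose i * i.factorial * a.factorial) *
          ((p + a).choose c * m.factorial * c.factorial) * p.factorial := by
        rw [f1, f2, f3, f4]; ring
      _ = _ := by ring
  · rw [Nat.choose_eq_zero_of_lt (by omega)]
    simp

open PowerSeries in
theorem coeff_ratio_pow_mul_of_pos (r n K : ℕ) (β : PowerSeries (PowerSeries ℤ))
    (hβ : β * (1 - C (X ^ r) * X) = 1) (hn : 1 ≤ n) (hK : 1 ≤ K) :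
    coeff n (((1 - C (X ^ r) * X) * mk 1) ^ K * (X * (mk 1 - C (X ^ r) * β))) =
      ∑ i ∈ Finset.range (n + 1), (-(X ^ r : PowerSeries ℤ)) ^ i *
        ((n.choose i * if i ≤ K then Nat.multichoose n (K - i) else 0 : ℕ) : PowerSeries ℤ) := by
  have hK0 : ((K : ℕ) : PowerSeries ℤ) ≠ 0 := by
    rw [← map_natCast (C : ℤ →+* PowerSeries ℤ)]
    rw [Ne, ← map_zero (C : ℤ →+* PowerSeries ℤ), C_injective.eq_iff]
    exact_mod_cast (by omega : K ≠ 0)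
  apply mul_left_cancel₀ hK0
  have h := congrArg (coeff n) (X_mul_derivative_ratio_pow _ β hβ K)
  have hc : ∀ f : PowerSeries (PowerSeries ℤ), coeff n ((K : PowerSeries (PowerSeries ℤ)) * f)
      = (K : PowerSeries ℤ) * coeff n f := fun f => by
    rw [← map_natCast (C : PowerSeries ℤ →+* _), coeff_C_mul]
  rw [hc] at h
  rw [← h]
  obtain ⟨m, rfl⟩ : ∃ m, n = m + 1 := ⟨n - 1, by omega⟩
  rw [coeff_succ_X_mul, coeff_derivative, coeff_ratio_pow, Finset.sum_mul, Finset.mul_sum]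
  refine Finset.sum_congr rfl fun i hi => ?_
  have := mul_choose_mul_multichoose (m + 1) K i hn hK (by have := Finset.mem_range.1 hi; omega)
  have h2 := congrArg (Nat.cast : ℕ → PowerSeries ℤ) this
  rw [Nat.cast_mul, Nat.cast_mul K] at h2
  push_cast at h2 ⊢
  linear_combination (-(X ^ r : PowerSeries ℤ)) ^ i * h2

open PowerSeries in
theorem coeff_sum_firstBlockSeries_mul (n r s t : ℕ) (hr : 1 ≤ r) (hs : 1 ≤ s)
    (hsn : s < r * n) :
    coeff s (coeff n (∑ k ∈ Finset.range s, firstBlockSeries r t * blockSeries r t ^ k)) =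
      ∑ i ∈ Finset.range (n + 1), (-1) ^ i * (n.choose i : ℤ) *
        (if (r * t + 1) * i ≤ s * t then (Nat.multichoose n (s * t - (r * t + 1) * i) : ℤ)
          else 0) := by
  have hn : 1 ≤ n := Nat.one_le_iff_ne_zero.2 (by rintro rfl; simp at hsn)
  set β : PowerSeries (PowerSeries ℤ) := rescale (X ^ r : PowerSeries ℤ) (mk 1) with hβd
  have hβ : β * (1 - C (X ^ r) * X) = 1 := by
    have : (1 - C (X ^ r) * X : PowerSeries (PowerSeries ℤ)) = rescale (X ^ r) (1 - X) := by
      rw [map_sub, map_one, rescale_X]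
    rw [this, hβd, ← map_mul, mk_one_mul_one_sub_eq_one, map_one]
  obtain ⟨Z, hZ⟩ : C (X : PowerSeries ℤ) ^ (s + 1) ∣
      firstBlockSeries r t * blockSeries r t ^ s := by
    rw [pow_succ']
    exact mul_dvd_mul (C_X_dvd_of_Icc r _) (pow_dvd_pow_of_dvd (C_X_dvd_of_Icc r _) s)
  obtain ⟨Y, hY⟩ := geometric_elimination (C X) (C (X ^ r)) X (1 - C (X ^ r) * X) (mk 1) β
    (blockSeries r t) (firstBlockSeries r t) Z s t hβ
    (by rw [← one_sub_mul_blockSeries r t hr, map_sub, map_one])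
    (by rw [← one_sub_mul_firstBlockSeries r t hr, map_sub, map_one]) hZ
  rw [hY, map_add, map_add, map_add, map_add]
  have hY0 : coeff s (coeff n (C (X : PowerSeries ℤ) ^ (s + 1) * Y)) = 0 := by
    rw [← map_pow, coeff_C_mul, coeff_X_pow_mul', if_neg (by omega)]
  have hQ0 : coeff s (coeff n (-(C (X ^ r : PowerSeries ℤ) * X * β))) = 0 := by
    obtain ⟨m, rfl⟩ : ∃ m, n = m + 1 := ⟨n - 1, by omega⟩
    rw [map_neg, map_neg, mul_assoc, coeff_C_mul, coeff_succ_X_mul, hβd, coeff_rescale, coeff_mk,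
      Pi.one_apply, mul_one, ← pow_succ', ← pow_mul, coeff_X_pow, if_neg hsn.ne, neg_zero]
  rw [hY0, hQ0, zero_add, add_zero, map_sum, map_sum]
  have hterm : ∀ k ∈ Finset.range s,
      coeff s (coeff n ((C (X : PowerSeries ℤ) * ((1 - C (X ^ r) * X) * mk 1) ^ t) ^ (k + 1) *
        (X * (mk 1 - C (X ^ r) * β)))) =
      coeff (s - (k + 1)) (coeff n (((1 - C (X ^ r) * X) * mk 1) ^ (t * (k + 1)) *
        (X * (mk 1 - C (X ^ r : PowerSeries ℤ) * β)))) := by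
    intro k hk
    rw [mul_pow, mul_assoc, ← map_pow, coeff_C_mul, coeff_X_pow_mul',
      if_pos (Nat.succ_le_of_lt (Finset.mem_range.1 hk)), pow_mul]
  rw [Finset.sum_congr rfl hterm]
  rcases Nat.eq_zero_or_pos t with rfl | ht
  · have hcoeff : ∀ k, coeff (s - (k + 1)) (coeff n (((1 - C (X ^ r) * X) * mk 1) ^ (0 * (k + 1)) *
        (X * (mk 1 - C (X ^ r : PowerSeries ℤ) * β)))) =
        (if s - (k + 1) = 0 then 1 else 0) - if s - (k + 1) = r * n then 1 else 0 := by
      intro k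
      obtain ⟨m, rfl⟩ : ∃ m, n = m + 1 := ⟨n - 1, by omega⟩
      rw [zero_mul, pow_zero, one_mul, coeff_succ_X_mul, map_sub, coeff_C_mul, hβd, coeff_rescale,
        coeff_mk, Pi.one_apply, mul_one, ← pow_succ', ← pow_mul, map_sub, coeff_one, coeff_X_pow]
    rw [Finset.sum_congr rfl fun k _ => hcoeff k, Finset.sum_eq_single (s - 1),
      Finset.sum_eq_single 0]
    · rw [if_pos (by omega), if_neg (by omega)]
      simp
    · intro i _ hi
      rw [if_neg (by simpa using hi), mul_zero]
    · simp
    · intro k hk hne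
      have := Finset.mem_range.1 hk
      rw [if_neg (by omega), if_neg (by omega), sub_zero]
    · intro h
      exact absurd (Finset.mem_range.2 (by omega)) h
  have hterm2 : ∀ k ∈ Finset.range s,
      coeff (s - (k + 1)) (coeff n (((1 - C (X ^ r) * X) * mk 1) ^ (t * (k + 1)) *
        (X * (mk 1 - C (X ^ r : PowerSeries ℤ) * β)))) =
      ∑ i ∈ Finset.range (n + 1), if k + 1 + r * i = s then (-1) ^ i * (n.choose i : ℤ) *
        (if (r * t + 1) * i ≤ s * t then (Nat.multichoose n (s * t - (r * t + 1) * i) : ℤ)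
          else 0) else 0 := by
    intro k hk
    rw [coeff_ratio_pow_mul_of_pos r n _ β hβ hn (Nat.mul_pos ht k.succ_pos), map_sum]
    refine Finset.sum_congr rfl fun i _ => ?_
    rw [neg_pow, ← pow_mul, mul_assoc, ← map_natCast (C : ℤ →+* PowerSeries ℤ)]
    have : ((-1 : PowerSeries ℤ)) ^ i = C ((-1) ^ i) := by simp
    rw [this, coeff_C_mul, coeff_mul_C, coeff_X_pow]
    have hk := Finset.mem_range.1 hk
    by_cases h : k + 1 + r * i = s
    · have e1 : t * (k + 1) + r * t * i = s * t := by rw [← h]; ring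
      have e2 : (r * t + 1) * i = r * t * i + i := by ring
      rw [if_pos (by omega), if_pos h, e2, ← e1]
      have e3 : (i ≤ t * (k + 1)) ↔ (r * t * i + i ≤ t * (k + 1) + r * t * i) := by omega
      have e4 : t * (k + 1) + r * t * i - (r * t * i + i) = t * (k + 1) - i := by omega
      simp only [e3, e4]
      push_cast
      split_ifs <;> ring
    · rw [if_neg (by omega), if_neg h]; simp
  rw [Finset.sum_congr rfl hterm2, Finset.sum_comm]
  refine Finset.sum_congr rfl fun i _ => ?_
  by_cases h : r * i < s
  · rw [Finset.sum_eq_single (s - r * i - 1)]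
    · rw [if_pos (by omega)]
    · intro k hk hne
      rw [if_neg (by omega)]
    · intro hne
      exact absurd (Finset.mem_range.2 (by omega)) hne
  · rw [Finset.sum_eq_zero fun k _ => if_neg (by omega), if_neg, mul_zero]
    push Not at h ⊢
    have h1 : s * t ≤ r * i * t := Nat.mul_le_mul_right t h
    have h2 : 0 < i := Nat.pos_of_ne_zero (by rintro rfl; omega)
    nlinarith

theorem sum_fiber_eq {α κ : Type*} [Fintype α] [DecidableEq κ] (f : α → κ) (m : α → ℕ) (p : κ) :
    ∑ a with f a = p, m a = ∑ a : {a // f a = p}, m a :=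
  Finset.sum_subtype _ (by simp) _

/-- The number of multiplicity functions with prescribed sums over the fibres of `f`. -/
theorem card_fiber_sums {α κ : Type*} [Fintype α] [Fintype κ] [DecidableEq α] [DecidableEq κ]
    (f : α → κ) (c : κ → ℕ) :
    Nat.card {m : α → ℕ // ∀ p, ∑ a with f a = p, m a = c p} =
      ∏ p, Nat.multichoose (Fintype.card {a // f a = p}) (c p) := by
  have e1 : {m : α → ℕ // ∀ p, ∑ a with f a = p, m a = c p} ≃
      {g : ∀ p, {a // f a = p} → ℕ // ∀ p, ∑ a, g p a = c p} :=
    { toFun := fun m => ⟨fun p a => m.1 a, fun p => by rw [← m.2 p, sum_fiber_eq]⟩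
      invFun := fun g => ⟨fun a => g.1 (f a) ⟨a, rfl⟩, fun p => by
        rw [← g.2 p, sum_fiber_eq]
        refine Finset.sum_congr rfl fun a _ => ?_
        obtain ⟨a, rfl⟩ := a
        rfl⟩
      left_inv := fun m => rfl
      right_inv := fun g => by
        ext p ⟨a, rfl⟩
        rfl }
  have e2 := Equiv.subtypePiEquivPi (β := fun p => {a // f a = p} → ℕ)
    (p := fun p g => ∑ a, g a = c p)
  rw [Nat.card_congr (e1.trans e2), Nat.card_pi]
  refine Finset.prod_congr rfl fun p _ => ?_
  rw [Nat.card_congr (Sym.equivNatSumOfFintype _ _).symm, Nat.card_eq_fintype_card,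
    Sym.card_sym_eq_multichoose]

theorem count_ofFn {α : Type*} [DecidableEq α] {N : ℕ} (x : Fin N → α) (a : α) :
    (List.ofFn x).count a = (Finset.univ.filter fun j => x j = a).card := by
  rw [← Multiset.coe_count, ← Fin.univ_val_map, Multiset.count_map, Finset.card_def,
    Finset.filter_val]
  simp only [eq_comm]

/-- Weakly increasing sequences are determined by their multiplicities, which are arbitrary. -/
theorem monotone_multiplicity_bijective {α : Type*} [Fintype α] [LinearOrder α] (N : ℕ) :
    Function.Bijective (fun x : {x : Fin N → α // Monotone x} =>
      (⟨fun a => (Finset.univ.filter fun j => x.1 j = a).card, by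
        rw [← Finset.card_eq_sum_card_fiberwise (fun _ _ => Finset.mem_coe.2 (Finset.mem_univ _))]
        simp⟩ : {m : α → ℕ // ∑ a, m a = N})) := by
  constructor
  · rintro ⟨x, hx⟩ ⟨y, hy⟩ h
    simp only [Subtype.mk.injEq] at h ⊢
    refine List.ofFn_injective (List.Perm.eq_of_sortedLE hx.sortedLE_ofFn hy.sortedLE_ofFn ?_)
    rw [List.perm_iff_count]
    intro a
    rw [count_ofFn, count_ofFn]
    exact congrFun h a
  · rintro ⟨m, hm⟩
    set S : Multiset α := ∑ a, m a • {a} with hS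
    have hcount : ∀ a, (S.sort).count a = m a := by
      intro a
      rw [← Multiset.coe_count, Multiset.sort_eq, hS, Multiset.count_sum']
      simp [Multiset.count_singleton]
    have hlen : (S.sort).length = N := by
      rw [Multiset.length_sort, hS, ← hm]
      simp
    subst hlen
    refine ⟨⟨(S.sort).get, ?_⟩, ?_⟩
    · have := Multiset.pairwise_sort S (· ≤ ·)
      intro i j hij
      rcases hij.eq_or_lt with rfl | h'
      · rfl
      · exact List.pairwise_iff_get.1 this i j h'
    · ext a
      simp only
      rw [← hcount a, ← count_ofFn, List.ofFn_get]

theorem card_fin_mod_eq (k t : ℕ) (p : Fin (k + 1)) :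
    Fintype.card {a : Fin ((k + 1) * t + 1) // Fin.ofNat (k + 1) a = p} =
      if p = 0 then t + 1 else t := by
  have h := Nat.count_modEq_card ((k + 1) * t + 1) k.succ_pos (p : ℕ)
  have h2 : Fintype.card {a : Fin ((k + 1) * t + 1) // Fin.ofNat (k + 1) a = p} =
      Nat.count (· ≡ p [MOD k + 1]) ((k + 1) * t + 1) := by
    rw [Fintype.card_subtype, Nat.count_eq_card_filter_range, Finset.card_filter,
      Finset.card_filter, ← Fin.sum_univ_eq_sum_range
        (fun i => if i ≡ p [MOD k + 1] then 1 else 0)]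
    refine Finset.sum_congr rfl fun a _ => ?_
    simp [Fin.ext_iff, Nat.ModEq, Nat.mod_eq_of_lt p.2]
  rw [h2, h, Nat.mod_eq_of_lt p.2]
  rcases k with _ | k
  · have : p = 0 := Fin.ext (by omega)
    simp [this, Nat.mod_one]
  · have h3 : ((k + 1 + 1) * t + 1) % (k + 1 + 1) = 1 := by
      rw [Nat.mul_add_mod, Nat.mod_eq_of_lt (by omega)]
    have h4 : ((k + 1 + 1) * t + 1) / (k + 1 + 1) = t := by
      rw [Nat.mul_add_div (by omega), Nat.div_eq_of_lt (by omega), add_zero]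
    rw [Nat.succ_eq_add_one, h3, h4]
    by_cases hp : p = 0
    · simp [hp]
    · have : (p : ℕ) ≠ 0 := fun h => hp (Fin.ext h)
      rw [if_neg (by omega), if_neg hp, add_zero]

theorem card_monotone_residues (N k t : ℕ) (c : Fin (k + 1) → ℕ) (hc : ∑ p, c p = N) :
    (Finset.univ.filter fun x : Fin N → Fin ((k + 1) * t + 1) => Monotone x ∧
      ∀ p, (Finset.univ.filter fun j => Fin.ofNat (k + 1) (x j) = p).card = c p).card =
      ∏ p, Nat.multichoose (if p = 0 then t + 1 else t) (c p) := by
  simp_rw [← card_fin_mod_eq k t]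
  rw [← card_fiber_sums, ← Nat.card_eq_finsetCard]
  set f : Fin ((k + 1) * t + 1) → Fin (k + 1) := fun a => Fin.ofNat (k + 1) a with hf
  have hsum : ∀ m : Fin ((k + 1) * t + 1) → ℕ, (∀ p, ∑ a with f a = p, m a = c p) →
      ∑ a, m a = N := by
    intro m hm
    rw [← hc, ← Finset.sum_fiberwise (s := Finset.univ) (g := f)]
    exact Finset.sum_congr rfl fun p _ => hm p
  let e := Equiv.ofBijective _ (monotone_multiplicity_bijective (α := Fin ((k + 1) * t + 1)) N)
  have e1 : {x : Fin N → Fin ((k + 1) * t + 1) // x ∈ Finset.univ.filter fun x => Monotone x ∧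
      ∀ p, (Finset.univ.filter fun j => f (x j) = p).card = c p} ≃
      {x : {x : Fin N → Fin ((k + 1) * t + 1) // Monotone x} //
        ∀ p, (Finset.univ.filter fun j => f (x.1 j) = p).card = c p} :=
    (Equiv.subtypeEquivRight (by simp)).trans (Equiv.subtypeSubtypeEquivSubtypeInter Monotone
      (fun x : Fin N → Fin ((k + 1) * t + 1) =>
        ∀ p, (Finset.univ.filter fun j => f (x j) = p).card = c p)).symm
  have e2 : {x : {x : Fin N → Fin ((k + 1) * t + 1) // Monotone x} //
        ∀ p, (Finset.univ.filter fun j => f (x.1 j) = p).card = c p} ≃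
      {m : {m : Fin ((k + 1) * t + 1) → ℕ // ∑ a, m a = N} //
        ∀ p, ∑ a with f a = p, m.1 a = c p} := by
    refine e.subtypeEquiv fun x => forall_congr' fun p => ?_
    have : (Finset.univ.filter fun j => f (x.1 j) = p).card =
        ∑ a with f a = p, (e x).1 a := by
      rw [Finset.card_eq_sum_card_fiberwise (f := x.1) (t := Finset.univ.filter fun a => f a = p)
        (fun j hj => by simpa using hj)]
      refine Finset.sum_congr rfl fun a ha => ?_
      change _ = (Finset.univ.filter fun j => x.1 j = a).card
      rw [Finset.filter_filter]
      congr 1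
      ext j
      have := (Finset.mem_filter.1 ha).2
      simp only [Finset.mem_filter, Finset.mem_univ, true_and]
      exact ⟨fun h => h.2, fun h => ⟨by rw [h, this], h⟩⟩
    rw [this]
  exact Nat.card_congr ((e1.trans e2).trans (Equiv.subtypeSubtypeEquivSubtype fun {m} => hsum m))

/-- The number of cyclic descents of a block assignment. -/
def cyclicDescents {n k : ℕ} (b : Fin n → Fin k) : ℕ :=
  (Finset.univ.filter fun j => b (cyc j) < b j).card

theorem cyc_eq_ofNat {N : ℕ} (j : Fin (N + 1)) : cyc j = Fin.ofNat (N + 1) (j + 1) := rfl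

/-- The lift to `ℕ` of the closed walk with block assignment `b` and extra turns `u`. -/
def walkLift {N k : ℕ} (b : Fin (N + 1) → Fin k) (u : Fin (N + 1) → ℕ) (j : ℕ) : ℕ :=
  b (Fin.ofNat _ j) + k * ∑ i ∈ Finset.range j,
    (u (Fin.ofNat _ i) + if b (Fin.ofNat _ (i + 1)) < b (Fin.ofNat _ i) then 1 else 0)

theorem walkLift_succ {N k : ℕ} (b : Fin (N + 1) → Fin k) (u : Fin (N + 1) → ℕ) (j : ℕ) :
    walkLift b u (j + 1) + b (Fin.ofNat _ j) = walkLift b u j + b (Fin.ofNat _ (j + 1)) +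
      k * (u (Fin.ofNat _ j) + if b (Fin.ofNat _ (j + 1)) < b (Fin.ofNat _ j) then 1 else 0) := by
  rw [walkLift, walkLift, Finset.sum_range_succ]
  ring

theorem monotone_walkLift {N k : ℕ} (b : Fin (N + 1) → Fin k) (u : Fin (N + 1) → ℕ) :
    Monotone (walkLift b u) := by
  refine monotone_nat_of_le_succ fun j => ?_
  have h := walkLift_succ b u j
  have h1 := (b (Fin.ofNat _ j)).2
  split_ifs at h with hd
  · rw [mul_add] at h
    omega
  · rw [Fin.lt_def] at hd
    omega

theorem walkLift_mod {N k : ℕ} (b : Fin (N + 1) → Fin k) (u : Fin (N + 1) → ℕ) (j : ℕ) :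
    walkLift b u j % k = b (Fin.ofNat _ j) := by
  rw [walkLift, Nat.add_mul_mod_self_left, Nat.mod_eq_of_lt (Fin.is_lt _)]

theorem walkLift_last {N k : ℕ} (b : Fin (N + 1) → Fin k) (u : Fin (N + 1) → ℕ) :
    walkLift b u (N + 1) = b 0 + k * (∑ i, u i + cyclicDescents b) := by
  rw [walkLift, ← Fin.sum_univ_eq_sum_range (fun i => u (Fin.ofNat (N + 1) i) +
    if b (Fin.ofNat _ (i + 1)) < b (Fin.ofNat _ i) then 1 else 0), Finset.sum_add_distrib,
    cyclicDescents, Finset.card_filter]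
  have h : Fin.ofNat (N + 1) (N + 1) = 0 := by ext; simp
  simp only [h, cyc_eq_ofNat, Fin.ofNat_val_eq_self]
  congr!

/-- Block assignments with prescribed block sizes together with a distribution of the remaining
turns are equinumerous with weakly increasing sequences of prescribed residues. -/
theorem card_sigma_eq_card_monotone (N k t : ℕ) (c : Fin (k + 1) → ℕ) :
    ((Finset.univ.filter fun b : Fin (N + 1) → Fin (k + 1) => b 0 = 0 ∧
        ∀ p, (Finset.univ.filter fun j => b j = p).card = c p + if p = 0 then 1 else 0).sigma
      fun b => if cyclicDescents b ≤ t then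
        Finset.piAntidiag (Finset.univ : Finset (Fin (N + 1))) (t - cyclicDescents b)
        else ∅).card =
    (Finset.univ.filter fun x : Fin N → Fin ((k + 1) * t + 1) => Monotone x ∧
      ∀ p, (Finset.univ.filter fun j => Fin.ofNat (k + 1) (x j) = p).card = c p).card := by
  have key : ∀ b u, b ∈ (Finset.univ.filter fun b : Fin (N + 1) → Fin (k + 1) => b 0 = 0 ∧
        ∀ p, (Finset.univ.filter fun j => b j = p).card = c p + if p = 0 then 1 else 0) ∧
        u ∈ (if cyclicDescents b ≤ t then
        Finset.piAntidiag (Finset.univ : Finset (Fin (N + 1))) (t - cyclicDescents b)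
        else ∅) ↔ (b 0 = 0 ∧
          ∀ p, (Finset.univ.filter fun j : Fin N => b j.succ = p).card = c p) ∧
          ∑ i, u i + cyclicDescents b = t := by
    intro b u
    refine and_congr ?_ ?_
    · simp only [Finset.mem_filter, Finset.mem_univ, true_and]
      refine and_congr_right fun hb => forall_congr' fun p => ?_
      rw [Finset.card_filter, Finset.card_filter, Fin.sum_univ_succ, hb, add_comm]
      simp only [eq_comm (a := (0 : Fin (k + 1)))]
      omega
    · split_ifs with h
      · simp only [Finset.mem_piAntidiag, Finset.mem_univ, implies_true, and_true]
        change ∑ i, u i = _ ↔ _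
        omega
      · simp only [Finset.notMem_empty, false_iff]
        omega
  have hlast : ∀ b : Fin (N + 1) → Fin (k + 1), ∀ u, b 0 = 0 → ∑ i, u i + cyclicDescents b = t →
      walkLift b u (N + 1) = (k + 1) * t := by
    intro b u hb hu
    rw [walkLift_last, hb, hu]
    simp
  have hofNat : ∀ j : Fin N, Fin.ofNat (N + 1) (j + 1) = j.succ := by
    intro j
    ext
    simp
  refine Finset.card_bij (fun q _ => fun j => Fin.ofNat _ (walkLift q.1 q.2 (j + 1))) ?_ ?_ ?_
  · rintro ⟨b, u⟩ hq
    obtain ⟨⟨hb, hc⟩, hu⟩ := (key b u).1 (Finset.mem_sigma.1 hq)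
    have hlt : ∀ j : Fin N, walkLift b u (j + 1) % ((k + 1) * t + 1) = walkLift b u (j + 1) :=
      fun j => Nat.mod_eq_of_lt (by
        rw [← hlast b u hb hu]
        exact Nat.lt_succ_of_le (monotone_walkLift b u (by omega)))
    simp only [Finset.mem_filter, Finset.mem_univ, true_and]
    refine ⟨fun i j hij => ?_, fun p => ?_⟩
    · rw [Fin.le_def]
      simp only [Fin.val_ofNat, hlt]
      exact monotone_walkLift b u (by simpa using hij)
    · rw [← hc p]
      congr 1
      ext j
      simp only [Finset.mem_filter, Finset.mem_univ, true_and, Fin.ext_iff, Fin.val_ofNat, hlt,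
        walkLift_mod, hofNat]
  · rintro ⟨b, u⟩ hq ⟨b', u'⟩ hq' h
    obtain ⟨⟨hb, hc⟩, hu⟩ := (key b u).1 (Finset.mem_sigma.1 hq)
    obtain ⟨⟨hb', hc'⟩, hu'⟩ := (key b' u').1 (Finset.mem_sigma.1 hq')
    have hX : ∀ j ≤ N + 1, walkLift b u j = walkLift b' u' j := by
      intro j hj
      rcases j with _ | j
      · simp [walkLift, hb, hb']
      · rcases (Nat.lt_succ_iff.1 hj).eq_or_lt with rfl | hj'
        · rw [hlast b u hb hu, hlast b' u' hb' hu']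
        · have h1 := congrArg Fin.val (congrFun h ⟨j, hj'⟩)
          simp only [Fin.val_ofNat] at h1
          rwa [Nat.mod_eq_of_lt, Nat.mod_eq_of_lt] at h1
          · rw [← hlast b' u' hb' hu']
            exact Nat.lt_succ_of_le (monotone_walkLift b' u' (by omega))
          · rw [← hlast b u hb hu]
            exact Nat.lt_succ_of_le (monotone_walkLift b u (by omega))
    have hbb : b = b' := by
      funext j
      have h1 := congrArg (· % (k + 1)) (hX j (by omega))
      simp only [walkLift_mod, Fin.ofNat_val_eq_self] at h1
      exact Fin.ext h1
    subst hbb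
    have huu : u = u' := by
      funext j
      have h1 := walkLift_succ b u j
      have h2 := walkLift_succ b u' j
      rw [hX _ (by omega), hX j (by omega)] at h1
      have h3 := Nat.eq_of_mul_eq_mul_left k.succ_pos (Nat.add_left_cancel (h1.symm.trans h2))
      simpa using h3
    rw [huu]
  · intro x hx
    simp only [Finset.mem_filter, Finset.mem_univ, true_and] at hx
    obtain ⟨hmono, hc⟩ := hx
    set Y : ℕ → ℕ := fun j => if h : j - 1 < N then (if j = 0 then 0 else x ⟨j - 1, h⟩)
      else if j = 0 then 0 else (k + 1) * t with hY
    have hY0 : Y 0 = 0 := by simp [hY]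
    have hYs : ∀ j : Fin N, Y (j + 1) = x j := by intro j; simp [hY]
    have hYl : Y (N + 1) = (k + 1) * t := by simp [hY]
    have hYmono : ∀ j ≤ N, Y j ≤ Y (j + 1) := by
      intro j hj
      rcases j with _ | j
      · rw [hY0]; exact Nat.zero_le _
      · have h1 := hYs ⟨j, hj⟩
        simp only at h1
        rw [h1]
        rcases hj.eq_or_lt with h | h
        · rw [h, hYl]
          exact Nat.lt_succ_iff.1 (Fin.is_lt _)
        · rw [hYs ⟨j + 1, h⟩]
          exact hmono (by simp [Fin.le_def])
    set b : Fin (N + 1) → Fin (k + 1) := fun j => Fin.ofNat _ (Y j) with hb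
    set u : Fin (N + 1) → ℕ := fun j => (Y (j + 1) - Y j) / (k + 1) with hu
    have hb0 : b 0 = 0 := by simp [hb, hY0]
    have hbY : ∀ j ≤ N + 1, (b (Fin.ofNat _ j) : ℕ) = Y j % (k + 1) := by
      intro j hj
      rcases hj.eq_or_lt with rfl | hj
      · have h : Fin.ofNat (N + 1) (N + 1) = 0 := by ext; simp
        rw [h, hb0, hYl]
        simp
      · simp [hb, Nat.mod_eq_of_lt hj]
    have hstep : ∀ x y : ℕ, x ≤ y → y + x % (k + 1) = x + y % (k + 1) +
        (k + 1) * ((y - x) / (k + 1) + if y % (k + 1) < x % (k + 1) then 1 else 0) := by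
      intro x y hxy
      obtain ⟨d, rfl⟩ := Nat.exists_eq_add_of_le hxy
      have h1 := Nat.mod_add_div d (k + 1)
      have h2 : x % (k + 1) < k + 1 := Nat.mod_lt x k.succ_pos
      have h3 : d % (k + 1) < k + 1 := Nat.mod_lt d k.succ_pos
      rw [Nat.add_sub_cancel_left, Nat.add_mod, mul_add]
      rcases lt_or_ge (x % (k + 1) + d % (k + 1)) (k + 1) with h | h
      · rw [Nat.mod_eq_of_lt h, if_neg (by omega)]
        omega
      · have h4 : (x % (k + 1) + d % (k + 1)) % (k + 1) =
            x % (k + 1) + d % (k + 1) - (k + 1) := by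
          rw [Nat.mod_eq_sub_mod h]
          exact Nat.mod_eq_of_lt (by omega)
        rw [h4, if_pos (by omega)]
        omega
    have hw : ∀ j ≤ N + 1, walkLift b u j = Y j := by
      intro j hj
      induction j with
      | zero => simp [walkLift, hb0, hY0]
      | succ j ih =>
        have h1 := walkLift_succ b u j
        rw [ih (by omega)] at h1
        have h2 := hstep _ _ (hYmono j (by omega))
        simp only [Fin.lt_def] at h1
        rw [hbY j (by omega), hbY (j + 1) hj] at h1
        have h3 : u (Fin.ofNat (N + 1) j) = (Y (j + 1) - Y j) / (k + 1) := by
          simp [hu, Nat.mod_eq_of_lt (show j < N + 1 by omega)]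
        rw [h3] at h1
        omega
    have hsum : ∑ i, u i + cyclicDescents b = t := by
      have h1 := walkLift_last b u
      rw [hw _ le_rfl, hYl, hb0] at h1
      have h2 : (k + 1) * t = (k + 1) * (∑ i, u i + cyclicDescents b) := by simpa using h1
      exact (Nat.eq_of_mul_eq_mul_left k.succ_pos h2).symm
    refine ⟨⟨b, u⟩, Finset.mem_sigma.2 ((key b u).2 ⟨⟨hb0, fun p => ?_⟩, hsum⟩), ?_⟩
    · rw [← hc p]
      congr 1
      ext j
      simp [hb, hYs]
    · funext j
      simp only
      rw [hw _ (by omega), hYs]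
      simp

theorem sum_multichoose_cyclicDescents (N k t : ℕ) (c : Fin (k + 1) → ℕ)
    (hc : ∑ p, c p = N + 1) (hc0 : 1 ≤ c 0) :
    ∑ b : Fin (N + 1) → Fin (k + 1) with b 0 = 0 ∧
        ∀ p, (Finset.univ.filter fun j => b j = p).card = c p,
      (if cyclicDescents b ≤ t then Nat.multichoose (N + 1) (t - cyclicDescents b) else 0) =
    Nat.multichoose (t + 1) (c 0 - 1) * ∏ p : Fin k, Nat.multichoose t (c p.succ) := by
  set c' : Fin (k + 1) → ℕ := fun p => c p - if p = 0 then 1 else 0 with hc'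
  have hcc : ∀ p, c p = c' p + if p = 0 then 1 else 0 := by
    intro p
    simp only [hc']
    split_ifs with h
    · subst h; omega
    · rfl
  have h1 := card_sigma_eq_card_monotone N k t c'
  have hsum : ∑ p, c' p = N := by
    have : ∑ p, c p = ∑ p, c' p + 1 := by
      rw [Finset.sum_congr rfl fun p _ => hcc p, Finset.sum_add_distrib]
      simp
    omega
  rw [card_monotone_residues N k t c' hsum, Finset.card_sigma] at h1
  simp only [← hcc] at h1
  rw [Fin.prod_univ_succ] at h1
  simp only [Fin.succ_ne_zero, if_true, if_false, hc', Nat.sub_zero] at h1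
  rw [← h1]
  refine Finset.sum_congr rfl fun b _ => ?_
  split_ifs with h
  · rw [← Nat.card_eq_finsetCard, Nat.card_congr ((Equiv.subtypeEquivRight
      (q := fun u : Fin (N + 1) → ℕ => ∑ i, u i = t - cyclicDescents b) (by simp)).trans
      (Sym.equivNatSumOfFintype (Fin (N + 1)) _).symm), Nat.card_eq_fintype_card,
      Sym.card_sym_eq_multichoose, Fintype.card_fin]
  · rfl

open PowerSeries in
theorem coeff_sum_Icc_pow (m l : ℕ) :
    coeff l (∑ i ∈ Finset.Icc 1 m, X ^ i : PowerSeries ℤ) = if 1 ≤ l ∧ l ≤ m then 1 else 0 := by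
  simp [coeff_X_pow]

open PowerSeries in
theorem coeff_firstBlockSeries_mul_pow (n r s t k : ℕ) :
    coeff s (coeff n (firstBlockSeries r t * blockSeries r t ^ k)) =
      ∑ c ∈ Finset.piAntidiag (Finset.univ : Finset (Fin (k + 1))) n,
        ∑ l ∈ Finset.piAntidiag (Finset.univ : Finset (Fin (k + 1))) s,
          if ∀ p, 1 ≤ l p ∧ l p ≤ r * c p - 1 then
            ((Nat.multichoose (t + 1) (c 0 - 1) *
              ∏ p : Fin k, Nat.multichoose t (c p.succ) : ℕ) : ℤ) else 0 := by
  set f : Fin (k + 1) → ℕ → ℕ := fun p c =>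
    Fin.cases (Nat.multichoose (t + 1) (c - 1)) (fun _ => Nat.multichoose t c) p with hf
  have hprod : firstBlockSeries r t * blockSeries r t ^ k = ∏ p : Fin (k + 1),
      mk fun c => (f p c : PowerSeries ℤ) * ∑ l ∈ Finset.Icc 1 (r * c - 1), X ^ l := by
    rw [Fin.prod_univ_succ]
    simp [hf, firstBlockSeries, blockSeries]
  rw [hprod, coeff_prod_univ, map_sum]
  refine Finset.sum_congr rfl fun c _ => ?_
  simp only [coeff_mk]
  rw [Finset.prod_mul_distrib, ← Nat.cast_prod, ← nsmul_eq_mul, map_nsmul, coeff_prod_univ,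
    nsmul_eq_mul, Finset.mul_sum]
  refine Finset.sum_congr rfl fun l _ => ?_
  simp only [coeff_sum_Icc_pow]
  rw [Finset.prod_ite_zero]
  simp [hf, Fin.prod_univ_succ]

/-- The decorated ordered set partition with block assignment `b` and decorations `l`. -/
def dospOfAssignment {n k : ℕ} (l : Fin k → ℕ) (b : Fin n → Fin k) :
    List (Finset (Fin n) × ℕ) :=
  List.ofFn fun p => (Finset.univ.filter fun x => b x = p, l p)

theorem posOf_dospOfAssignment {n k : ℕ} (l : Fin k → ℕ) (b : Fin n → Fin k) (x : Fin n) :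
    posOf (dospOfAssignment l b) x = ∑ p with p < b x, l p := by
  have hidx : (dospOfAssignment l b).findIdx (fun B => !decide (x ∉ B.1)) = b x := by
    rw [List.findIdx_eq (by simp [dospOfAssignment])]
    refine ⟨by simp [dospOfAssignment], fun j hj => ?_⟩
    simp only [dospOfAssignment, List.getElem_ofFn]
    simp only [Finset.mem_filter, Finset.mem_univ, true_and, decide_not, Bool.not_not,
      decide_eq_false_iff_not, Fin.ext_iff]
    omega
  rw [posOf, List.takeWhile_eq_take_findIdx_not, hidx, List.map_take, dospOfAssignment,
    List.map_ofFn, List.sum_take_ofFn]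
  rfl

theorem cyc_bijective (N : ℕ) : Function.Bijective (cyc : Fin (N + 1) → Fin (N + 1)) := by
  have h : (cyc : Fin (N + 1) → Fin (N + 1)) = Equiv.addRight 1 := by
    funext i
    ext
    simp [cyc, Fin.val_add]
  rw [h]
  exact Equiv.bijective _

theorem wind_dospOfAssignment {n k s : ℕ} (l : Fin k → ℕ) (b : Fin n → Fin k)
    (hl : ∀ p, 1 ≤ l p) (hs : ∑ p, l p = s) (i : Fin n) :
    (wind s (dospOfAssignment l b) i : ℤ) = posOf (dospOfAssignment l b) (cyc i) -
      posOf (dospOfAssignment l b) i + s * if b (cyc i) < b i then 1 else 0 := by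
  have hlt : ∀ p q : Fin k, p < q → ∑ j with j < p, l j < ∑ j with j < q, l j := by
    intro p q hpq
    refine Finset.sum_lt_sum_of_subset (i := p) (fun j hj => ?_) (by simpa using hpq) (by simp)
      (hl p) (by simp)
    simp only [Finset.mem_filter, Finset.mem_univ, true_and] at hj ⊢
    exact hj.trans hpq
  have hls : ∀ p : Fin k, ∑ j with j < p, l j < s := by
    intro p
    rw [← hs]
    exact Finset.sum_lt_sum_of_subset (i := p) (Finset.filter_subset _ _) (Finset.mem_univ _)
      (by simp) (hl p) (by simp)
  have h1 := hls (b i)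
  have h2 := hls (b (cyc i))
  rw [wind, posOf_dospOfAssignment, posOf_dospOfAssignment,
    Int.toNat_of_nonneg (Int.emod_nonneg _ (by omega))]
  split_ifs with h
  · have h3 := hlt _ _ h
    rw [← Int.add_emod_right, Int.emod_eq_of_lt (by omega) (by omega), mul_one]
  · have h3 : ∑ j with j < b i, l j ≤ ∑ j with j < b (cyc i), l j := by
      rcases (not_lt.1 h).eq_or_lt with h | h
      · rw [h]
      · exact (hlt _ _ h).le
    rw [Int.emod_eq_of_lt (by omega) (by omega), mul_zero, add_zero]

theorem level_dospOfAssignment {N k s : ℕ} (l : Fin k → ℕ) (b : Fin (N + 1) → Fin k)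
    (hl : ∀ p, 1 ≤ l p) (hs : ∑ p, l p = s) :
    level s (dospOfAssignment l b) = s * cyclicDescents b := by
  have h : (level s (dospOfAssignment l b) : ℤ) = s * cyclicDescents b := by
    rw [level, Nat.cast_sum, Finset.sum_congr rfl fun i _ => wind_dospOfAssignment l b hl hs i,
      Finset.sum_add_distrib, Finset.sum_sub_distrib,
      (cyc_bijective N).sum_comp fun i => (posOf (dospOfAssignment l b) i : ℤ), sub_self,
      zero_add, ← Finset.mul_sum, cyclicDescents, Finset.card_filter]
    push_cast
    rfl
  exact_mod_cast h

theorem dospOfAssignment_valid_iff {N k r s d : ℕ} (hs : 1 ≤ s) (l : Fin (k + 1) → ℕ)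
    (b : Fin (N + 1) → Fin (k + 1)) :
    (IsDOSP (N + 1) s (dospOfAssignment l b) ∧
      (∀ B ∈ dospOfAssignment l b, B.2 ≤ r * B.1.card - 1) ∧
      FirstBlock (dospOfAssignment l b) ∧ level s (dospOfAssignment l b) = s * d) ↔
    (∑ p, l p = s ∧ b 0 = 0 ∧
      ∀ p, 1 ≤ l p ∧ l p ≤ r * (Finset.univ.filter fun x => b x = p).card - 1) ∧
      cyclicDescents b = d := by
  have hsum : ((dospOfAssignment l b).map Prod.snd).sum = ∑ p, l p := by
    rw [dospOfAssignment, List.map_ofFn, List.sum_ofFn]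
    rfl
  have hfirst : FirstBlock (dospOfAssignment l b) ↔ b 0 = 0 := by
    simp only [FirstBlock, dospOfAssignment, List.ofFn_succ, List.headI_cons, Finset.mem_filter,
      Finset.mem_univ, true_and]
    exact ⟨fun h => h 0 rfl, fun h x hx => by rw [Fin.ext hx (b := 0), h]⟩
  have hbound : (∀ B ∈ dospOfAssignment l b, B.2 ≤ r * B.1.card - 1) ↔
      ∀ p, l p ≤ r * (Finset.univ.filter fun x => b x = p).card - 1 :=
    List.forall_mem_ofFn_iff
  have hpos : (∀ B ∈ dospOfAssignment l b, B.1.Nonempty ∧ 1 ≤ B.2) ↔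
      ∀ p, (Finset.univ.filter fun x => b x = p).Nonempty ∧ 1 ≤ l p :=
    List.forall_mem_ofFn_iff
  have hdisj : List.Pairwise (fun B C => Disjoint B.1 C.1) (dospOfAssignment l b) := by
    rw [dospOfAssignment, List.pairwise_ofFn]
    intro i j hij
    rw [Finset.disjoint_filter]
    rintro x _ rfl
    exact hij.ne
  have hcover : ∀ x, ∃ B ∈ dospOfAssignment l b, x ∈ B.1 := fun x =>
    ⟨_, List.mem_ofFn.2 ⟨b x, rfl⟩, by simp⟩
  rw [IsDOSP, hsum, hfirst, hbound, hpos]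
  constructor
  · rintro ⟨⟨h1, -, -, h2⟩, h3, h4, h5⟩
    rw [level_dospOfAssignment l b (fun p => (h1 p).2) h2] at h5
    exact ⟨⟨h2, h4, fun p => ⟨(h1 p).2, h3 p⟩⟩, Nat.eq_of_mul_eq_mul_left hs h5⟩
  · rintro ⟨⟨h1, h2, h3⟩, rfl⟩
    refine ⟨⟨fun p => ⟨?_, (h3 p).1⟩, hdisj, hcover, h1⟩, fun p => (h3 p).2, h2,
      level_dospOfAssignment l b (fun p => (h3 p).1) h1⟩
    rw [← Finset.card_pos, Nat.pos_iff_ne_zero]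
    intro h
    have := h3 p
    rw [h] at this
    omega

theorem IsDOSP.exists_eq_dospOfAssignment {N s : ℕ} {P : List (Finset (Fin (N + 1)) × ℕ)}
    (hP : IsDOSP (N + 1) s P) :
    ∃ (k : ℕ) (l : Fin (k + 1) → ℕ) (b : Fin (N + 1) → Fin (k + 1)),
      P = dospOfAssignment l b := by
  obtain ⟨m, g, rfl⟩ : ∃ m, ∃ g : Fin m → Finset (Fin (N + 1)) × ℕ, P = List.ofFn g :=
    ⟨P.length, P.get, (List.ofFn_get P).symm⟩
  obtain ⟨-, hdisj, hcover, -⟩ := hP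
  have hcov : ∀ x, ∃ p, x ∈ (g p).1 := by
    intro x
    obtain ⟨B, hB, hx⟩ := hcover x
    obtain ⟨p, rfl⟩ := List.mem_ofFn.1 hB
    exact ⟨p, hx⟩
  choose b hb using hcov
  rcases m with _ | k
  · exact (b 0).elim0
  refine ⟨k, fun p => (g p).2, b, congrArg List.ofFn (funext fun p => Prod.ext ?_ rfl)⟩
  ext x
  simp only [Finset.mem_filter, Finset.mem_univ, true_and]
  refine ⟨fun hx => ?_, fun h => h ▸ hb x⟩
  rw [List.pairwise_ofFn] at hdisj
  rcases lt_trichotomy (b x) p with h | h | h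
  · exact absurd hx (Finset.disjoint_left.1 (hdisj h) (hb x))
  · exact h
  · exact absurd (hb x) (Finset.disjoint_left.1 (hdisj h) hx)

theorem dospOfAssignment_injective {n k : ℕ} {l l' : Fin k → ℕ} {b b' : Fin n → Fin k}
    (h : dospOfAssignment l b = dospOfAssignment l' b') : l = l' ∧ b = b' := by
  have h1 := List.ofFn_injective h
  refine ⟨funext fun p => congrArg Prod.snd (congrFun h1 p), funext fun x => ?_⟩
  have h2 : (Finset.univ.filter fun y => b y = b x) = Finset.univ.filter fun y => b' y = b x :=
    congrArg Prod.fst (congrFun h1 (b x))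
  have h3 : x ∈ Finset.univ.filter fun y => b' y = b x := h2 ▸ by simp
  simpa [eq_comm] using h3

/-- Decorations and block assignments of the decorated ordered set partitions with at most `s`
blocks, `0` in the first block and decorations bounded in terms of the block sizes. -/
def validAssignments (N r s : ℕ) :
    Finset (Σ k : ℕ, (Fin (k + 1) → ℕ) × (Fin (N + 1) → Fin (k + 1))) :=
  (Finset.range s).sigma fun _ =>
    (Finset.piAntidiag Finset.univ s ×ˢ Finset.univ).filter fun q => q.2 0 = 0 ∧
      ∀ p, 1 ≤ q.1 p ∧ q.1 p ≤ r * (Finset.univ.filter fun x => q.2 x = p).card - 1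

theorem mem_validAssignments {N r s k : ℕ} {l : Fin (k + 1) → ℕ}
    {b : Fin (N + 1) → Fin (k + 1)} :
    (⟨k, l, b⟩ : Σ k : ℕ, (Fin (k + 1) → ℕ) × (Fin (N + 1) → Fin (k + 1))) ∈
      validAssignments N r s ↔ ∑ p, l p = s ∧ b 0 = 0 ∧
      ∀ p, 1 ≤ l p ∧ l p ≤ r * (Finset.univ.filter fun x => b x = p).card - 1 := by
  simp only [validAssignments, Finset.mem_sigma, Finset.mem_range, Finset.mem_filter,
    Finset.mem_product, Finset.mem_piAntidiag, Finset.mem_univ, implies_true, and_true]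
  refine ⟨fun h => h.2, fun h => ⟨?_, h⟩⟩
  have h1 : ∑ _p : Fin (k + 1), 1 ≤ ∑ p, l p := Finset.sum_le_sum fun p _ => (h.2.2 p).1
  rw [h.1] at h1
  simpa using h1

theorem card_dosp_eq_card_validAssignments (N r s d : ℕ) (hs : 1 ≤ s) :
    Nat.card {P : List (Finset (Fin (N + 1)) × ℕ) //
      IsDOSP (N + 1) s P ∧ (∀ B ∈ P, B.2 ≤ r * B.1.card - 1) ∧ FirstBlock P ∧
        level s P = s * d} =
    ((validAssignments N r s).filter fun q => cyclicDescents q.2.2 = d).card := by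
  rw [← Nat.card_eq_finsetCard]
  symm
  refine Nat.card_eq_of_bijective (fun q => ⟨dospOfAssignment q.1.2.1 q.1.2.2, ?_⟩) ⟨?_, ?_⟩
  · obtain ⟨⟨k, l, b⟩, hq⟩ := q
    rw [Finset.mem_filter, mem_validAssignments] at hq
    exact (dospOfAssignment_valid_iff hs l b).2 hq
  · rintro ⟨⟨k, l, b⟩, hq⟩ ⟨⟨k', l', b'⟩, hq'⟩ h
    have h1 : dospOfAssignment l b = dospOfAssignment l' b' := congrArg Subtype.val h
    obtain rfl : k = k' := by simpa [dospOfAssignment] using congrArg List.length h1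
    obtain ⟨rfl, rfl⟩ := dospOfAssignment_injective h1
    rfl
  · rintro ⟨P, hP⟩
    obtain ⟨k, l, b, rfl⟩ := hP.1.exists_eq_dospOfAssignment
    exact ⟨⟨⟨k, l, b⟩, Finset.mem_filter.2
      (by rw [mem_validAssignments]; exact (dospOfAssignment_valid_iff hs l b).1 hP)⟩, rfl⟩

theorem sum_card_mul_multichoose_eq (N r s t : ℕ) :
    ∑ d ∈ Finset.range (t + 1),
      ((validAssignments N r s).filter fun q => cyclicDescents q.2.2 = d).card *
        Nat.multichoose (N + 1) (t - d) =
    ∑ q ∈ validAssignments N r s, if cyclicDescents q.2.2 ≤ t then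
      Nat.multichoose (N + 1) (t - cyclicDescents q.2.2) else 0 := by
  simp only [Finset.card_filter, Finset.sum_mul]
  rw [Finset.sum_comm]
  refine Finset.sum_congr rfl fun q _ => ?_
  simp [ite_mul]

open PowerSeries in
theorem sum_validAssignments_eq_coeff (N r s t : ℕ) :
    ((∑ q ∈ validAssignments N r s, if cyclicDescents q.2.2 ≤ t then
      Nat.multichoose (N + 1) (t - cyclicDescents q.2.2) else 0 : ℕ) : ℤ) =
    coeff s (coeff (N + 1)
      (∑ k ∈ Finset.range s, firstBlockSeries r t * blockSeries r t ^ k)) := by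
  rw [map_sum, map_sum, validAssignments, Finset.sum_sigma, Nat.cast_sum]
  refine Finset.sum_congr rfl fun k _ => ?_
  rw [coeff_firstBlockSeries_mul_pow, Finset.sum_comm, Finset.sum_filter, Finset.sum_product,
    Nat.cast_sum]
  refine Finset.sum_congr rfl fun l _ => ?_
  have hfib : ∀ b ∈ (Finset.univ : Finset (Fin (N + 1) → Fin (k + 1))),
      (fun p => (Finset.univ.filter fun x => b x = p).card) ∈
        Finset.piAntidiag (Finset.univ : Finset (Fin (k + 1))) (N + 1) := by
    intro b _
    rw [Finset.mem_piAntidiag]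
    refine ⟨?_, by simp⟩
    rw [← Finset.card_eq_sum_card_fiberwise fun _ _ => Finset.mem_coe.2 (Finset.mem_univ _)]
    simp
  rw [← Finset.sum_fiberwise_of_maps_to hfib, Nat.cast_sum]
  refine Finset.sum_congr rfl fun c hc => ?_
  rw [Finset.mem_piAntidiag] at hc
  split_ifs with h
  · have hc0 : 1 ≤ c 0 := by
      rw [Nat.one_le_iff_ne_zero]
      intro h0
      have := h 0
      rw [h0] at this
      omega
    rw [← sum_multichoose_cyclicDescents N k t c hc.1 hc0, Finset.sum_filter, Finset.sum_filter]
    congr 1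
    refine Finset.sum_congr rfl fun b _ => ?_
    simp only [funext_iff]
    by_cases hb : ∀ p, (Finset.univ.filter fun x => b x = p).card = c p
    · simp only [hb, h, implies_true, and_true, if_true]
    · simp only [hb, and_false, if_false]
  · rw [Nat.cast_eq_zero]
    refine Finset.sum_eq_zero fun b hb => if_neg fun hb' => h fun p => ?_
    rw [← congrFun (Finset.mem_filter.1 hb).2 p]
    exact hb'.2 p

/-- Conjecture 3: for `n ≥ 1`, `r ≥ 1`, `1 ≤ s ≤ rn−1`, in `ℤ[[x]]`,
`(1−x)^n · Σ_t E(t) x^t = Σ_d m_d x^d`, where `E(t)` counts lattice points of the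
`t`-th dilate of the cross-section `I_{r,s}^n` of the cube `[0,r]^n`, and `m_d`
counts decorated ordered set partitions of `{1,…,n}` with decorations summing to
`s`, satisfying `1 ≤ l_i ≤ r|L_i|−1`, with `1 ∈ L₁` and winding number `d`. -/
theorem hstar_cube_cross_section (n r s : ℕ) (hn : 1 ≤ n) (hr : 1 ≤ r)
    (hs : 1 ≤ s) (hs' : s ≤ r * n - 1) :
    (1 - PowerSeries.X : PowerSeries ℤ) ^ n *
        PowerSeries.mk (fun t =>
          (Nat.card {y : Fin n → ℤ //
              (∀ i, 0 ≤ y i ∧ y i ≤ (r : ℤ) * (t : ℤ)) ∧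
                ∑ i, y i = (s : ℤ) * (t : ℤ)} : ℤ))
      = PowerSeries.mk (fun d =>
          (Nat.card {P : List (Finset (Fin n) × ℕ) //
              IsDOSP n s P ∧ (∀ B ∈ P, B.2 ≤ r * B.1.card - 1) ∧ FirstBlock P ∧
                level s P = s * d} : ℤ)) := by
  obtain ⟨N, rfl⟩ : ∃ N, n = N + 1 := ⟨n - 1, by omega⟩
  have hsn : s < r * (N + 1) := by
    have := Nat.mul_pos hr hn
    omega
  set m : PowerSeries ℤ := PowerSeries.mk fun d =>
    (Nat.card {P : List (Finset (Fin (N + 1)) × ℕ) //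
      IsDOSP (N + 1) s P ∧ (∀ B ∈ P, B.2 ≤ r * B.1.card - 1) ∧ FirstBlock P ∧
        level s P = s * d} : ℤ) with hm
  have key : PowerSeries.mk (fun t =>
      (Nat.card {y : Fin (N + 1) → ℤ //
        (∀ i, 0 ≤ y i ∧ y i ≤ (r : ℤ) * (t : ℤ)) ∧ ∑ i, y i = (s : ℤ) * (t : ℤ)} : ℤ)) =
      (PowerSeries.mk 1) ^ (N + 1) * m := by
    ext t
    rw [PowerSeries.coeff_mk, mul_comm _ m, PowerSeries.coeff_mul,
      Finset.Nat.sum_antidiagonal_eq_sum_range_succ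
        (fun i j => PowerSeries.coeff i m * PowerSeries.coeff j ((PowerSeries.mk 1) ^ (N + 1)))]
    simp only [coeff_mk_one_pow, hm, PowerSeries.coeff_mk,
      card_dosp_eq_card_validAssignments N r s _ hs]
    have h1 := sum_validAssignments_eq_coeff N r s t
    rw [← sum_card_mul_multichoose_eq, coeff_sum_firstBlockSeries_mul _ _ _ _ hr hs hsn,
      ← card_lattice_points] at h1
    push_cast at h1
    exact h1.symm
  rw [key, ← mul_assoc, ← mul_pow, mul_comm (1 - PowerSeries.X : PowerSeries ℤ),
    PowerSeries.mk_one_mul_one_sub_eq_one, one_pow, one_mul]
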